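/- Let T > 0 and 𝔐 ∈ ℕ. For each k ≥ 1 and each 𝔪 = 1,…,𝔐 there exist functions a₁^{𝔪,k}, a₂^{𝔪,k} ∈ C^∞(ℝ;[−1,1]) such that for every choice of bounded, uniformly continuous functions G_i^𝔪 : P×[0,T] → ℝ and F_{i,l}^{𝔪,𝔫} : P×[0,T]×[−1,1] → ℝ (i,l = 1,2; 𝔪,𝔫 = 1,…,𝔐) satisfying F_{i,l}^{𝔪,𝔫}(x,t,−1) = F_{i,l}^{𝔪,𝔫}(x,t,1) for all x ∈ P, t ∈ [0,T], one has, uniformly in (x,t) ∈ P×[0,T] and in 𝔪 = 1,…,𝔐, as k → ∞: ∫₀ᵗ a_i^{𝔪,k}(s)( G_i^𝔪(x,s) + Σ_{l=1,2} Σ_{𝔫=1}^{𝔐} F_{i,l}^{𝔪,𝔫}(x,s,a_l^{𝔫,k}(s)) ) ds converges to (1/2)∫₀ᵗ ( F_{2,1}^{𝔪,𝔪}(x,s,1) − F_{2,1}^{𝔪,𝔪}(x,s,0) ) ds when i = 2, and to 0 when i = 1. -/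

import Mathlib

noncomputable section

open MeasureTheory Real Set Filter Topology

abbrev E3 : Type := EuclideanSpace ℝ (Fin 3)

/-- The point of `ℝ³` with coordinates `(a, b, c)`. -/
def e3 (a b c : ℝ) : E3 := (EuclideanSpace.equiv (Fin 3) ℝ).symm ![a, b, c]

/-- Spatial partial derivative `∂ᵢ w`. -/
def pd3 (w : E3 → ℝ) (i : Fin 3) (x : E3) : ℝ := fderiv ℝ w x (EuclideanSpace.single i 1)

/-- Laplacian of a scalar function on `ℝ³`. -/
def lap3 (w : E3 → ℝ) (x : E3) : ℝ := ∑ i : Fin 3, pd3 (fun y => pd3 w i y) i x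

/-- Divergence of a vector field on `ℝ³`. -/
def div3 (u : E3 → E3) (x : E3) : ℝ := ∑ i : Fin 3, pd3 (fun y => u y i) i x

/-- `|∇u|²`. -/
def gradsq (u : E3 → E3) (x : E3) : ℝ :=
  ∑ i : Fin 3, ∑ j : Fin 3, (pd3 (fun y => u y j) i x) ^ 2

/-- The pressure function corresponding to a vector field `u`. -/
def pressureFn (u : E3 → E3) (x : E3) : ℝ :=
  ∫ y : E3, (∑ i : Fin 3, ∑ j : Fin 3,
    pd3 (fun z => u z j) i y * pd3 (fun z => u z i) j y) / (4 * π * ‖x - y‖)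

/-- Rotation about the `x₁` axis by angle `θ`. -/
def rot3 (θ : ℝ) (x : E3) : E3 :=
  e3 (x 0) (x 1 * Real.cos θ - x 2 * Real.sin θ) (x 1 * Real.sin θ + x 2 * Real.cos θ)

abbrev Pt : Type := ℝ × ℝ

/-- The open upper half-plane `P`. -/
def Pset : Set Pt := {p | 0 < p.2}

def pdx (g : Pt → ℝ) (p : Pt) : ℝ := fderiv ℝ g p (1, 0)

def pdy (g : Pt → ℝ) (p : Pt) : ℝ := fderiv ℝ g p (0, 1)

/-- The operator `L`, `Lg = Δg + ∂₂ g / x₂ - g / x₂²`. -/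
def Lop (g : Pt → ℝ) (p : Pt) : ℝ :=
  (pdx (fun q => pdx g q) p + pdy (fun q => pdy g q) p) + pdy g p / p.2 - g p / p.2 ^ 2

/-- `div (x₂ v(x₁,x₂))` for a planar vector field `v = (w₁, w₂)`. -/
def div2w (w₁ w₂ : Pt → ℝ) (p : Pt) : ℝ :=
  pdx (fun q => q.2 * w₁ q) p + pdy (fun q => q.2 * w₂ q) p

/-- `g ∈ C₀^∞(P)`. -/
def SmoothCompSuppP (g : Pt → ℝ) : Prop :=
  ContDiff ℝ (⊤ : ℕ∞) g ∧ HasCompactSupport g ∧ tsupport g ⊆ Pset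

/-- Distance to the `x₁`-axis. -/
def rad (x : E3) : ℝ := Real.sqrt ((x 1) ^ 2 + (x 2) ^ 2)

/-- The cylindrical projection `R⁻¹`. -/
def Rinv (x : E3) : Pt := (x 0, rad x)

/-- The rotation `R(V)` of a subset `V` of the (closed) upper half-plane. -/
def Rset (V : Set Pt) : Set E3 := {x | Rinv x ∈ V}

def wcomp (v₁ v₂ f : Pt → ℝ) (p : Pt) : ℝ := Real.sqrt (f p ^ 2 - (v₁ p ^ 2 + v₂ p ^ 2))

/-- The axisymmetric vector field `u[v,f]` determined (in cylindrical coordinates) by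
`u[v,f](x₁,x₂,0) = (v₁(x₁,x₂), v₂(x₁,x₂), √(f(x₁,x₂)² − |v(x₁,x₂)|²))` for `x₂ ≥ 0`. -/
def uvf (v₁ v₂ f : Pt → ℝ) (x : E3) : E3 :=
  e3 (v₁ (Rinv x))
    (v₂ (Rinv x) * (x 1 / rad x) - wcomp v₁ v₂ f (Rinv x) * (x 2 / rad x))
    (v₂ (Rinv x) * (x 2 / rad x) + wcomp v₁ v₂ f (Rinv x) * (x 1 / rad x))

/-- The planar pressure function `p[v,f]`, the restriction to `{x₃ = 0}` of the pressure
function `p*[v,f]` corresponding to `u[v,f]`. -/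
def pvf (v₁ v₂ f : Pt → ℝ) (q : Pt) : ℝ := pressureFn (uvf v₁ v₂ f) (e3 q.1 q.2 0)

def zf : Pt → ℝ := fun _ => 0

/-- First component of the pressure interaction function `F[v,f] = ∇p[0,f] − ∇p[v,f]`. -/
def Fpi1 (v₁ v₂ f : Pt → ℝ) (q : Pt) : ℝ := pdx (pvf zf zf f) q - pdx (pvf v₁ v₂ f) q

/-- Second component of the pressure interaction function `F[v,f] = ∇p[0,f] − ∇p[v,f]`. -/
def Fpi2 (v₁ v₂ f : Pt → ℝ) (q : Pt) : ℝ := pdy (pvf zf zf f) q - pdy (pvf v₁ v₂ f) q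

/-- A structure `(v, f, φ)` (with `v = (w₁,w₂)`) on a set `U ⋐ P`. -/
structure StructureOn (U : Set Pt) (w₁ w₂ f φ : Pt → ℝ) : Prop where
  smooth_w₁ : ContDiff ℝ (⊤ : ℕ∞) w₁
  smooth_w₂ : ContDiff ℝ (⊤ : ℕ∞) w₂
  smooth_f : ContDiff ℝ (⊤ : ℕ∞) f
  smooth_phi : ContDiff ℝ (⊤ : ℕ∞) φ
  hcs_w₁ : HasCompactSupport w₁
  hcs_w₂ : HasCompactSupport w₂
  hcs_f : HasCompactSupport f
  hcs_phi : HasCompactSupport φ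
  supp_w₁ : tsupport w₁ ⊆ {p | φ p = 1}
  supp_w₂ : tsupport w₂ ⊆ {p | φ p = 1}
  supp_f : tsupport f = closure U
  f_nonneg : ∀ p, 0 ≤ f p
  phi_mem : ∀ p, φ p ∈ Icc (0:ℝ) 1
  supp_phi : tsupport φ ⊆ U
  div_v : ∀ p ∈ U, div2w w₁ w₂ p = 0
  f_gt : ∀ p ∈ U, Real.sqrt (w₁ p ^ 2 + w₂ p ^ 2) < f p
  Lf_pos : ∀ p ∈ U, φ p ≠ 1 → 0 < Lop f p

/-- `u` is a weak solution of the Navier–Stokes inequality with viscosity `ν`: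
the local energy inequality holds against every nonnegative test function
`φ ∈ C₀^∞(ℝ³ × (0,∞))`. -/
def IsWeakNSI (ν : ℝ) (u : E3 → ℝ → E3) : Prop :=
  ∀ φ : E3 × ℝ → ℝ, ContDiff ℝ (⊤ : ℕ∞) φ → HasCompactSupport φ →
    tsupport φ ⊆ {z : E3 × ℝ | 0 < z.2} → (∀ z, 0 ≤ φ z) →
    2 * ν * (∫ t in Ioi (0:ℝ), ∫ x : E3, gradsq (fun y => u y t) x * φ (x, t)) ≤
      ∫ t in Ioi (0:ℝ), ∫ x : E3,
        (‖u x t‖ ^ 2 * (deriv (fun s => φ (x, s)) t + ν * lap3 (fun y => φ (y, t)) x)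
          + (‖u x t‖ ^ 2 + 2 * pressureFn (fun y => u y t) x) *
              (∑ i : Fin 3, u x t i * pd3 (fun y => φ (y, t)) i x))

/-- The regularity `sup_{t>0} ‖u(t)‖_{L²} < ∞` and `∇u ∈ L²(ℝ³ × (0,∞))`. -/
def NSIRegular (u : E3 → ℝ → E3) : Prop :=
  (∃ M : ℝ, ∀ t, 0 < t →
    Integrable (fun x : E3 => ‖u x t‖ ^ 2) ∧ (∫ x : E3, ‖u x t‖ ^ 2) ≤ M) ∧
  IntegrableOn (fun z : E3 × ℝ => gradsq (fun y => u y z.2) z.1) (univ ×ˢ Ioi 0)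

/-- `u` is unbounded in every neighbourhood of `(x₀, T₀)`. -/
def UnboundedNear (u : E3 → ℝ → E3) (x₀ : E3) (T₀ : ℝ) : Prop :=
  ∀ ε > 0, ∀ M : ℝ, ∃ x : E3, ∃ t : ℝ, 0 < t ∧ ‖x - x₀‖ < ε ∧ |t - T₀| < ε ∧ M < ‖u x t‖

/-- The singular set of `u`. -/
def SingularSet (u : E3 → ℝ → E3) : Set (E3 × ℝ) :=
  {z | 0 < z.2 ∧ UnboundedNear u z.1 z.2}

/-- `u · (∂_t u + (u·∇)u + ∇p)`, where `p` is the pressure corresponding to `u(·,t)`. -/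
def eulerOp (u : E3 → ℝ → E3) (x : E3) (t : ℝ) : ℝ :=
  ∑ j : Fin 3, u x t j *
    (deriv (fun s => u x s j) t
      + (∑ i : Fin 3, u x t i * pd3 (fun y => u y t j) i x)
      + pd3 (pressureFn (fun y => u y t)) j x)

/-- `u · (∂_t u − νΔu + (u·∇)u + ∇p)`, where `p` is the pressure corresponding to `u(·,t)`. -/
def nsOp (ν : ℝ) (u : E3 → ℝ → E3) (x : E3) (t : ℝ) : ℝ :=
  ∑ j : Fin 3, u x t j *
    (deriv (fun s => u x s j) t - ν * lap3 (fun y => u y t j) x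
      + (∑ i : Fin 3, u x t i * pd3 (fun y => u y t j) i x)
      + pd3 (pressureFn (fun y => u y t)) j x)

/-- The time-dependent modification `h_{1,t}` of `f₁`. -/
def h1d (f₁ φ₁ : Pt → ℝ) (δ t : ℝ) (p : Pt) : ℝ :=
  Real.sqrt (f₁ p ^ 2 - 2 * t * δ * φ₁ p)

/-- The time-dependent modification `h_{2,t}` of `f₂`. -/
def h2d (w₁ w₂ f₁ φ₁ b₁ b₂ f₂ φ₂ : Pt → ℝ) (δ t : ℝ) (p : Pt) : ℝ :=
  Real.sqrt (f₂ p ^ 2 - 2 * t * δ * φ₂ p +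
    ∫ s in (0:ℝ)..t,
      (b₁ p * Fpi1 w₁ w₂ (h1d f₁ φ₁ δ s) p + b₂ p * Fpi2 w₁ w₂ (h1d f₁ φ₁ δ s) p))

/-- The constant `D` of Lemma 3.4 (i). -/
def Dconst (w₁ : Pt → ℝ) : ℝ := (9 / (4 * π)) * ∫ y : E3, (w₁ (Rinv y)) ^ 2

/-- A (planar, open) rectangle. -/
def IsRect (V : Set Pt) : Prop :=
  ∃ a₁ b₁ a₂ b₂ : ℝ, a₁ < b₁ ∧ a₂ < b₂ ∧ V = Ioo a₁ b₁ ×ˢ Ioo a₂ b₂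

/-- A smooth odd function which equals `1` on `[1, ∞)` and `-1` on `(-∞, -1]`. -/
def smoothSign (y : ℝ) : ℝ := Real.smoothTransition y - Real.smoothTransition (-y)

lemma smoothSign_contDiff {n : ℕ∞} : ContDiff ℝ n smoothSign :=
  Real.smoothTransition.contDiff.sub (Real.smoothTransition.contDiff.comp contDiff_neg)

lemma smoothSign_neg (y : ℝ) : smoothSign (-y) = -smoothSign y := by
  simp [smoothSign]

lemma abs_smoothSign_le_one (y : ℝ) : |smoothSign y| ≤ 1 := by
  have h1 := Real.smoothTransition.nonneg y
  have h2 := Real.smoothTransition.le_one y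
  have h3 := Real.smoothTransition.nonneg (-y)
  have h4 := Real.smoothTransition.le_one (-y)
  rw [abs_le, smoothSign]
  constructor <;> linarith

lemma smoothSign_sq_eq_one {y : ℝ} (hy : 1 ≤ |y|) : smoothSign y ^ 2 = 1 := by
  rcases le_abs.1 hy with h | h
  · rw [smoothSign, Real.smoothTransition.one_of_one_le h,
      Real.smoothTransition.zero_of_nonpos (by linarith)]
    norm_num
  · rw [smoothSign, Real.smoothTransition.one_of_one_le h,
      Real.smoothTransition.zero_of_nonpos (by linarith)]
    norm_num

/-- For `a ≠ 0`, the set where finitely many functions `L * sin (a j * s)` are smaller than `1`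
has small measure in `[0, T]` when `L` is large. -/
lemma exists_volume_sin_lt (T : ℝ) (N : ℕ) (a : ℕ → ℝ) (ha : ∀ j, a j ≠ 0) {ε : ENNReal}
    (hε : 0 < ε) :
    ∃ L : ℕ, volume ({s : ℝ | ∃ j < N, |(L : ℝ) * Real.sin (a j * s)| < 1} ∩ Icc 0 T) ≤ ε := by
  set A : ℕ → Set ℝ :=
    fun L => {s : ℝ | ∃ j < N, |(L : ℝ) * Real.sin (a j * s)| < 1} ∩ Icc 0 T with hA
  have hmeas : ∀ L, MeasurableSet (A L) := by
    intro L
    refine MeasurableSet.inter ?_ measurableSet_Icc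
    have : {s : ℝ | ∃ j < N, |(L : ℝ) * Real.sin (a j * s)| < 1} =
        ⋃ j, ⋃ _ : j < N, {s : ℝ | |(L : ℝ) * Real.sin (a j * s)| < 1} := by
      ext s; simp
    rw [this]
    exact (isOpen_iUnion fun j => isOpen_iUnion fun _ =>
      isOpen_lt (by fun_prop) continuous_const).measurableSet
  have hanti : Antitone A := by
    rintro L L' hL s ⟨⟨j, hj, hs⟩, hsT⟩
    refine ⟨⟨j, hj, lt_of_le_of_lt ?_ hs⟩, hsT⟩
    rw [abs_mul, abs_mul]
    gcongr
  have hzero : volume (⋂ L, A L) = 0 := by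
    have hcount : (⋃ j : ℕ, range fun n : ℤ => (n : ℝ) * π / a j).Countable :=
      countable_iUnion fun j => countable_range _
    refine measure_mono_null ?_ (hcount.measure_zero volume)
    intro s hs
    by_contra hcon
    have hne : ∀ j, Real.sin (a j * s) ≠ 0 := by
      intro j h0
      obtain ⟨n, hn⟩ := Real.sin_eq_zero_iff.1 h0
      refine hcon (mem_iUnion.2 ⟨j, n, ?_⟩)
      have := ha j
      change (n : ℝ) * π / a j = s
      rw [hn]
      field_simp
    have hev : ∀ j ∈ Finset.range N,
        ∀ᶠ L : ℕ in atTop, 1 ≤ |(L : ℝ) * Real.sin (a j * s)| := by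
      intro j _
      have : Tendsto (fun L : ℕ => (L : ℝ) * |Real.sin (a j * s)|) atTop atTop :=
        tendsto_natCast_atTop_atTop.atTop_mul_const (abs_pos.2 (hne j))
      filter_upwards [this.eventually_ge_atTop 1] with L hL
      rwa [abs_mul, Nat.abs_cast]
    obtain ⟨L, hL⟩ := ((Filter.eventually_all_finset _).2 hev).exists
    obtain ⟨⟨j, hj, hlt⟩, -⟩ := mem_iInter.1 hs L
    exact absurd hlt (not_lt.2 (hL j (Finset.mem_range.2 hj)))
  have hfin : ∃ L, volume (A L) ≠ ⊤ :=
    ⟨0, ((measure_mono inter_subset_right).trans_lt measure_Icc_lt_top).ne⟩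
  have hlim := tendsto_measure_iInter_atTop (fun L => (hmeas L).nullMeasurableSet) hanti hfin
  rw [hzero] at hlim
  obtain ⟨L, hL⟩ := (hlim.eventually (ge_mem_nhds hε)).exists
  exact ⟨L, hL⟩

/-- Smooth approximate Rademacher functions at frequency `k + 1`: the `j`-th one changes sign under
a shift by `1 / (2 ^ (j + 1) * (k + 1))`, which leaves all later ones invariant. -/
lemma exists_smooth_rademacher (T : ℝ) (N k : ℕ) :
    ∃ r : ℕ → ℝ → ℝ, (∀ j, ContDiff ℝ (⊤ : ℕ∞) (r j)) ∧ (∀ j s, |r j s| ≤ 1) ∧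
      (∀ j, Function.Antiperiodic (r j) (1 / (2 ^ (j + 1) * ((k : ℝ) + 1)))) ∧
      (∀ i j, i < j → Function.Periodic (r j) (1 / (2 ^ (i + 1) * ((k : ℝ) + 1)))) ∧
      volume ({s : ℝ | ∃ j < N, r j s ^ 2 ≠ 1} ∩ Icc 0 T) ≤ ENNReal.ofReal (1 / ((k : ℝ) + 1)) := by
  have hk : (0 : ℝ) < (k : ℝ) + 1 := by positivity
  obtain ⟨L, hL⟩ := exists_volume_sin_lt T N (fun j => 2 * π * 2 ^ j * ((k : ℝ) + 1))
    (fun j => by positivity) (ε := ENNReal.ofReal (1 / ((k : ℝ) + 1)))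
    (ENNReal.ofReal_pos.2 (by positivity))
  refine ⟨fun j s => smoothSign ((L : ℝ) * Real.sin (2 * π * 2 ^ j * ((k : ℝ) + 1) * s)),
    fun j => ?_, fun j s => abs_smoothSign_le_one _, fun j s => ?_, fun i j hij s => ?_, ?_⟩
  · exact smoothSign_contDiff.comp (by fun_prop)
  · have : 2 * π * 2 ^ j * ((k : ℝ) + 1) * (s + 1 / (2 ^ (j + 1) * ((k : ℝ) + 1))) =
        2 * π * 2 ^ j * ((k : ℝ) + 1) * s + π := by
      field_simp; ring
    simp only
    rw [this, Real.sin_add_pi, mul_neg, smoothSign_neg]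
  · obtain ⟨d, rfl⟩ := Nat.exists_eq_add_of_lt hij
    have : 2 * π * 2 ^ (i + d + 1) * ((k : ℝ) + 1) * (s + 1 / (2 ^ (i + 1) * ((k : ℝ) + 1))) =
        2 * π * 2 ^ (i + d + 1) * ((k : ℝ) + 1) * s + (2 ^ d : ℕ) * (2 * π) := by
      push_cast; field_simp; ring
    simp only
    rw [this, Real.sin_add_nat_mul_two_pi]
  · refine (measure_mono ?_).trans hL
    rintro s ⟨⟨j, hj, hs⟩, hsT⟩
    refine ⟨⟨j, hj, ?_⟩, hsT⟩
    by_contra hcon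
    exact hs (smoothSign_sq_eq_one (not_lt.1 hcon))

lemma abs_integral_le_of_antiperiodic {w : ℝ → ℝ} {h C : ℝ} (hw : Continuous w)
    (hh : 0 < h) (hanti : Function.Antiperiodic w h) (hC : ∀ s, |w s| ≤ C) (t : ℝ) :
    |∫ s in (0:ℝ)..t, w s| ≤ C * (2 * h) := by
  have hint : ∀ a b, IntervalIntegrable w volume a b := fun a b => hw.intervalIntegrable a b
  have hper : Function.Periodic (fun t => ∫ s in (0:ℝ)..t, w s) (2 * h) := by
    intro t
    have h1 : ∫ s in (t + h)..(t + 2 * h), w s = -∫ s in t..(t + h), w s := by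
      have : t + 2 * h = (t + h) + h := by ring
      rw [this, ← intervalIntegral.integral_comp_add_right, ← intervalIntegral.integral_neg]
      exact intervalIntegral.integral_congr fun s _ => hanti s
    simp only
    rw [← intervalIntegral.integral_add_adjacent_intervals (hint 0 t) (hint t (t + 2 * h)),
      ← intervalIntegral.integral_add_adjacent_intervals (hint t (t + h)) (hint (t + h) _), h1]
    ring
  obtain ⟨y, hy, hty⟩ := hper.exists_mem_Ico₀ (by positivity) t
  rw [show ∫ s in (0:ℝ)..t, w s = ∫ s in (0:ℝ)..y, w s from hty]
  have hC0 : 0 ≤ C := (abs_nonneg _).trans (hC 0)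
  have := intervalIntegral.norm_integral_le_of_norm_le_const (a := 0) (b := y) (f := w) (C := C)
    fun s _ => hC s
  rw [Real.norm_eq_abs, sub_zero, abs_of_nonneg hy.1] at this
  exact this.trans (mul_le_mul_of_nonneg_left hy.2.le hC0)

/-- If `f` is bounded by `C` on `[0, T]` and vanishes off `B`, then its integrals are at most
`C` times the measure of `B ∩ [0, T]`. -/
lemma abs_integral_le_of_eq_zero {f : ℝ → ℝ} {B : Set ℝ} {T C μ t : ℝ} (hB : MeasurableSet B)
    (hμ : 0 ≤ μ) (hvol : volume (B ∩ Icc 0 T) ≤ ENNReal.ofReal μ) (ht : t ∈ Icc 0 T)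
    (hC : ∀ s ∈ Icc 0 T, |f s| ≤ C) (hf : ∀ s ∈ Icc 0 T, s ∉ B → f s = 0) :
    |∫ s in (0:ℝ)..t, f s| ≤ C * μ := by
  have hC0 : 0 ≤ C := (abs_nonneg _).trans (hC t ht)
  have hsub : Ioc 0 t ⊆ Icc 0 T := fun s hs => ⟨hs.1.le, hs.2.trans ht.2⟩
  have hle : volume (Ioc 0 t ∩ B) ≤ ENNReal.ofReal μ :=
    (measure_mono fun s hs => (⟨hs.2, hsub hs.1⟩ : s ∈ B ∩ Icc 0 T)).trans hvol
  rw [intervalIntegral.integral_of_le ht.1]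
  have h1 : ∫ s in Ioc 0 t, f s = ∫ s in Ioc 0 t ∩ B, f s := by
    rw [← setIntegral_indicator hB]
    refine setIntegral_congr_fun measurableSet_Ioc fun s hs => ?_
    by_cases hsB : s ∈ B
    · simp [hsB]
    · simp [hsB, hf s (hsub hs) hsB]
  rw [h1, ← Real.norm_eq_abs]
  refine (norm_setIntegral_le_of_norm_le_const (hle.trans_lt ENNReal.ofReal_lt_top)
    fun s hs => hC s (hsub hs.1)).trans ?_
  exact mul_le_mul_of_nonneg_left (ENNReal.toReal_le_of_le_ofReal hμ hle) hC0

lemma abs_integral_mul_le {w h : ℝ → ℝ} {T D C ε δ ω : ℝ} (hw : Continuous w)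
    (hwD : ∀ s, |w s| ≤ D) (hwε : ∀ t ∈ Icc 0 T, |∫ s in (0:ℝ)..t, w s| ≤ ε)
    (hh : ContinuousOn h (Icc 0 T)) (hhC : ∀ s ∈ Icc 0 T, |h s| ≤ C)
    (hhω : ∀ s ∈ Icc 0 T, ∀ s' ∈ Icc 0 T, |s - s'| ≤ δ → |h s - h s'| ≤ ω) (hδ : 0 < δ)
    (n : ℕ) {t : ℝ} (ht : t ∈ Icc 0 T) (htn : t ≤ n * δ) :
    |∫ s in (0:ℝ)..t, w s * h s| ≤ n * (C * (2 * ε)) + D * ω * t := by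
  induction n generalizing t with
  | zero =>
    have : t = 0 := le_antisymm (by simpa using htn) ht.1
    simp [this]
  | succ n ih =>
    set u := max 0 (t - δ)
    have hut : u ≤ t := max_le ht.1 (by linarith)
    have hu0 : 0 ≤ u := le_max_left _ _
    have huT : u ∈ Icc 0 T := ⟨hu0, hut.trans ht.2⟩
    have hun : u ≤ n * δ := by
      refine max_le (by positivity) ?_
      push_cast at htn
      linarith
    have htu : t - u ≤ δ := by
      have := le_max_right 0 (t - δ)
      linarith
    have hD0 : 0 ≤ D := (abs_nonneg _).trans (hwD 0)
    have hint : ∀ a ∈ Icc 0 T, ∀ b ∈ Icc 0 T,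
        IntervalIntegrable (fun s => w s * h s) volume a b := fun a ha b hb =>
      ((hw.continuousOn.mul hh).mono (uIcc_subset_Icc ha hb)).intervalIntegrable
    have h0T : (0:ℝ) ∈ Icc 0 T := ⟨le_rfl, ht.1.trans ht.2⟩
    have hwi : ∀ a b, IntervalIntegrable w volume a b := fun a b => hw.intervalIntegrable a b
    have hsplit : ∫ s in (0:ℝ)..t, w s * h s = (∫ s in (0:ℝ)..u, w s * h s) +
        (h u * ((∫ s in (0:ℝ)..t, w s) - ∫ s in (0:ℝ)..u, w s) +
          ∫ s in u..t, w s * (h s - h u)) := by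
      rw [intervalIntegral.integral_interval_sub_left (hwi _ _) (hwi _ _),
        ← intervalIntegral.integral_const_mul,
        ← intervalIntegral.integral_add ((hwi _ _).const_mul _),
        ← intervalIntegral.integral_add_adjacent_intervals (hint 0 h0T u huT) (hint u huT t ht)]
      · congr 1
        exact intervalIntegral.integral_congr fun s _ => by ring
      · have := (hint u huT t ht).sub ((hwi u t).const_mul (h u))
        refine this.congr fun s _ => ?_
        ring
    have hlast : |∫ s in u..t, w s * (h s - h u)| ≤ D * ω * (t - u) := by
      have := intervalIntegral.norm_integral_le_of_norm_le_const (a := u) (b := t)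
        (f := fun s => w s * (h s - h u)) (C := D * ω) fun s hs => by
          rw [uIoc_of_le hut] at hs
          have hsT : s ∈ Icc 0 T := ⟨hu0.trans hs.1.le, hs.2.trans ht.2⟩
          rw [Real.norm_eq_abs, abs_mul]
          refine mul_le_mul (hwD s) (hhω s hsT u huT ?_) (abs_nonneg _) hD0
          rw [abs_of_nonneg (by linarith [hs.1])]
          linarith [hs.2]
      rwa [Real.norm_eq_abs, abs_of_nonneg (sub_nonneg.2 hut)] at this
    have hmid : |h u * ((∫ s in (0:ℝ)..t, w s) - ∫ s in (0:ℝ)..u, w s)| ≤ C * (2 * ε) := by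
      rw [abs_mul]
      refine mul_le_mul (hhC u huT) ?_ (abs_nonneg _) ((abs_nonneg _).trans (hhC u huT))
      refine (abs_sub _ _).trans ?_
      linarith [hwε t ht, hwε u huT]
    rw [hsplit]
    refine (abs_add_le _ _).trans ((add_le_add (ih huT hun) (abs_add_le _ _)).trans ?_)
    push_cast
    nlinarith [hlast, hmid]

/-- Time integrals of `f k x` from `0` to `t` tend to zero uniformly on `Pset × [0, T]`. -/
def NullIntegral (T : ℝ) (f : ℕ → Pt → ℝ → ℝ) : Prop :=
  (∀ k, ∀ x ∈ Pset, ContinuousOn (f k x) (Icc 0 T)) ∧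
    ∀ ε > 0, ∀ᶠ k in atTop, ∀ x ∈ Pset, ∀ t ∈ Icc 0 T, |∫ s in (0:ℝ)..t, f k x s| < ε

/-- Continuous weights bounded by `2`, whose integrals over `[0, t]` are at most `2 / (k + 1)`. -/
structure WeaklyNull (T : ℝ) (w : ℕ → ℝ → ℝ) : Prop where
  continuous : ∀ k, Continuous (w k)
  abs_le : ∀ k s, |w k s| ≤ 2
  integral_le : ∀ k, ∀ t ∈ Icc 0 T, |∫ s in (0:ℝ)..t, w k s| ≤ 2 / ((k : ℝ) + 1)

lemma tendsto_const_div_add_one (C : ℝ) :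
    Tendsto (fun k : ℕ => C / ((k : ℝ) + 1)) atTop (𝓝 0) :=
  tendsto_const_nhds.div_atTop (tendsto_atTop_add_const_right _ _ tendsto_natCast_atTop_atTop)

namespace NullIntegral

variable {T : ℝ} {f g : ℕ → Pt → ℝ → ℝ}

lemma intervalIntegrable (hf : NullIntegral T f) (k : ℕ) {x : Pt} (hx : x ∈ Pset) {t : ℝ}
    (ht : t ∈ Icc 0 T) : IntervalIntegrable (f k x) volume 0 t :=
  ((hf.1 k x hx).mono (uIcc_subset_Icc ⟨le_rfl, ht.1.trans ht.2⟩ ht)).intervalIntegrable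

lemma zero : NullIntegral T fun _ _ _ => 0 :=
  ⟨fun _ _ _ => continuousOn_const, fun ε hε => by simp [hε]⟩

lemma add (hf : NullIntegral T f) (hg : NullIntegral T g) :
    NullIntegral T fun k x s => f k x s + g k x s := by
  refine ⟨fun k x hx => (hf.1 k x hx).add (hg.1 k x hx), fun ε hε => ?_⟩
  filter_upwards [hf.2 (ε / 2) (by linarith), hg.2 (ε / 2) (by linarith)] with k h1 h2 x hx t ht
  rw [intervalIntegral.integral_add (hf.intervalIntegrable k hx ht)
    (hg.intervalIntegrable k hx ht)]
  linarith [abs_add_le (∫ s in (0:ℝ)..t, f k x s) (∫ s in (0:ℝ)..t, g k x s),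
    h1 x hx t ht, h2 x hx t ht]

lemma sum {ι : Type*} (I : Finset ι) {f : ι → ℕ → Pt → ℝ → ℝ}
    (hf : ∀ i ∈ I, NullIntegral T (f i)) : NullIntegral T fun k x s => ∑ i ∈ I, f i k x s := by
  classical
  induction I using Finset.induction_on with
  | empty => simpa using zero
  | insert i I hi ih =>
    simp only [Finset.sum_insert hi]
    exact (hf i (Finset.mem_insert_self i I)).add
      (ih fun j hj => hf j (Finset.mem_insert_of_mem hj))

lemma tendstoUniformlyOn {Φ : ℕ → Pt × ℝ → ℝ} {Ψ : Pt × ℝ → ℝ} (hf : NullIntegral T f)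
    (h : ∀ k, ∀ x ∈ Pset, ∀ t ∈ Icc 0 T, Φ k (x, t) - Ψ (x, t) = ∫ s in (0:ℝ)..t, f k x s) :
    TendstoUniformlyOn Φ Ψ atTop (Pset ×ˢ Icc 0 T) := by
  rw [Metric.tendstoUniformlyOn_iff]
  intro ε hε
  filter_upwards [hf.2 ε hε] with k hk
  rintro ⟨x, t⟩ ⟨hx, ht⟩
  rw [dist_comm, Real.dist_eq, h k x hx t ht]
  exact hk x hx t ht

end NullIntegral

lemma WeaklyNull.of_antiperiodic {T : ℝ} {w : ℕ → ℝ → ℝ} (hw : ∀ k, Continuous (w k))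
    (hw1 : ∀ k s, |w k s| ≤ 1) (j : ℕ)
    (hj : ∀ k : ℕ, Function.Antiperiodic (w k) (1 / (2 ^ (j + 1) * ((k : ℝ) + 1)))) :
    WeaklyNull T w := by
  refine ⟨hw, fun k s => (hw1 k s).trans one_le_two, fun k t _ => ?_⟩
  refine (abs_integral_le_of_antiperiodic (hw k) (by positivity) (hj k) (hw1 k) t).trans ?_
  have h2 : (1:ℝ) ≤ 2 ^ (j + 1) := one_le_pow₀ one_le_two
  have hk : (0:ℝ) < (k : ℝ) + 1 := by positivity
  rw [one_mul, mul_one_div]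
  exact div_le_div_of_nonneg_left zero_le_two hk (le_mul_of_one_le_left hk.le h2)

/-- A weakly null weight against a bounded uniformly continuous function. -/
lemma WeaklyNull.nullIntegral_mul {T : ℝ} {w : ℕ → ℝ → ℝ} (hw : WeaklyNull T w)
    {H : Pt → ℝ → ℝ} {C : ℝ} (hC : ∀ x ∈ Pset, ∀ t ∈ Icc 0 T, |H x t| ≤ C)
    (hH : UniformContinuousOn (fun z : Pt × ℝ => H z.1 z.2) (Pset ×ˢ Icc 0 T)) :
    NullIntegral T fun k x s => w k s * H x s := by
  have hcont : ∀ x ∈ Pset, ContinuousOn (H x) (Icc 0 T) := fun x hx =>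
    hH.continuousOn.comp (f := fun s => (x, s)) (by fun_prop) fun s hs => ⟨hx, hs⟩
  refine ⟨fun k x hx => (hw.continuous k).continuousOn.mul (hcont x hx), fun ε hε => ?_⟩
  rcases lt_or_ge T 0 with hT | hT
  · exact Eventually.of_forall fun k x _ t ht => absurd (ht.1.trans ht.2) (not_le.2 hT)
  set ω := ε / (4 * (T + 1))
  have hω0 : 0 < ω := by positivity
  obtain ⟨δ, hδ, hδω⟩ := Metric.uniformContinuousOn_iff.1 hH ω hω0
  obtain ⟨n, hn⟩ := exists_nat_ge (T / (δ / 2))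
  have hlim := tendsto_const_div_add_one (n * (C * (2 * 2)))
  filter_upwards [hlim.eventually_lt_const (show (0:ℝ) < ε / 2 by linarith)] with k hk x hx t ht
  have hle := abs_integral_mul_le (hw.continuous k) (hw.abs_le k) (hw.integral_le k) (hcont x hx)
    (hC x hx) (δ := δ / 2) (ω := ω) (fun s hs s' hs' hss => by
      have := hδω (x, s) ⟨hx, hs⟩ (x, s') ⟨hx, hs'⟩ (by
        rw [Prod.dist_eq, dist_self, Real.dist_eq]
        exact max_lt hδ (by linarith))
      rw [Real.dist_eq] at this
      exact this.le) (by positivity) n ht (ht.2.trans ((div_le_iff₀ (by positivity)).1 hn))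
  have h1 : (n : ℝ) * (C * (2 * (2 / ((k : ℝ) + 1)))) = n * (C * (2 * 2)) / ((k : ℝ) + 1) := by
    ring
  have h2 : 2 * ω * t ≤ ε / 2 := by
    have : ω * (4 * (T + 1)) = ε := div_mul_cancel₀ _ (by positivity)
    nlinarith [ht.2]
  rw [h1] at hle
  linarith

/-- The integrals of `b k * F x (c k)` tend to those of `(l / 2) * (F x 1 - F x 0)`, provided that
outside the small sets `B k` the function `c k` takes values in `{-1, 0, 1}`,
with `q k = 1` where `|c k| = 1` and `q k = -1` where `c k = 0`. -/
lemma nullIntegral_mul_comp {T l C : ℝ} {B : ℕ → Set ℝ} {b c q : ℕ → ℝ → ℝ}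
    (hBm : ∀ k, MeasurableSet (B k))
    (hB : ∀ k : ℕ, volume (B k ∩ Icc 0 T) ≤ ENNReal.ofReal (1 / ((k : ℝ) + 1)))
    (hb : WeaklyNull T b) (hbq : WeaklyNull T fun k s => b k s * q k s - l)
    (hc : ∀ k, Continuous (c k)) (hc1 : ∀ k s, c k s ∈ Icc (-1:ℝ) 1)
    (hgood : ∀ k, ∀ s ∉ B k, (c k s = -1 ∨ c k s = 1) ∧ q k s = 1 ∨ c k s = 0 ∧ q k s = -1)
    {F : Pt → ℝ → ℝ → ℝ}
    (hFC : ∀ x ∈ Pset, ∀ t ∈ Icc 0 T, ∀ a ∈ Icc (-1:ℝ) 1, |F x t a| ≤ C)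
    (hF : UniformContinuousOn (fun z : (Pt × ℝ) × ℝ => F z.1.1 z.1.2 z.2)
      ((Pset ×ˢ Icc 0 T) ×ˢ Icc (-1:ℝ) 1))
    (hF1 : ∀ x ∈ Pset, ∀ t ∈ Icc 0 T, F x t (-1) = F x t 1) :
    NullIntegral T fun k x s => b k s * F x s (c k s) - l / 2 * (F x s 1 - F x s 0) := by
  have hm1 : (1:ℝ) ∈ Icc (-1:ℝ) 1 := by norm_num
  have hm0 : (0:ℝ) ∈ Icc (-1:ℝ) 1 := by norm_num
  have huc : ∀ a ∈ Icc (-1:ℝ) 1,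
      UniformContinuousOn (fun z : Pt × ℝ => F z.1 z.2 a) (Pset ×ˢ Icc 0 T) := fun a ha =>
    hF.comp (f := fun z : Pt × ℝ => (z, a))
      ((uniformContinuous_id.prodMk uniformContinuous_const).uniformContinuousOn)
      fun z hz => ⟨hz, ha⟩
  have hcont : ∀ a ∈ Icc (-1:ℝ) 1, ∀ x ∈ Pset, ContinuousOn (fun s => F x s a) (Icc 0 T) :=
    fun a ha x hx => (huc a ha).continuousOn.comp (f := fun s => (x, s)) (by fun_prop)
      fun s hs => ⟨hx, hs⟩
  have hcomp : ∀ k, ∀ x ∈ Pset, ContinuousOn (fun s => F x s (c k s)) (Icc 0 T) :=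
    fun k x hx => hF.continuousOn.comp (f := fun s => ((x, s), c k s))
      (by have := hc k; fun_prop) fun s hs => ⟨⟨hx, hs⟩, hc1 k s⟩
  have hadd : NullIntegral T fun k x s => b k s * ((F x s 1 + F x s 0) * (1 / 2)) := by
    refine hb.nullIntegral_mul (C := C) (fun x hx t ht => ?_) ?_
    · have h1 := abs_le.1 (hFC x hx t ht 1 hm1)
      have h0 := abs_le.1 (hFC x hx t ht 0 hm0)
      rw [abs_le]; constructor <;> linarith
    · rw [uniformContinuousOn_iff_restrict]
      exact ((uniformContinuousOn_iff_restrict.1 (huc 1 hm1)).add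
        (uniformContinuousOn_iff_restrict.1 (huc 0 hm0))).mul_const' _
  have hsub : NullIntegral T fun k x s =>
      (b k s * q k s - l) * ((F x s 1 - F x s 0) * (1 / 2)) := by
    refine hbq.nullIntegral_mul (C := C) (fun x hx t ht => ?_) ?_
    · have h1 := abs_le.1 (hFC x hx t ht 1 hm1)
      have h0 := abs_le.1 (hFC x hx t ht 0 hm0)
      rw [abs_le]; constructor <;> linarith
    · rw [uniformContinuousOn_iff_restrict]
      exact ((uniformContinuousOn_iff_restrict.1 (huc 1 hm1)).sub
        (uniformContinuousOn_iff_restrict.1 (huc 0 hm0))).mul_const' _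
  have hmain := hadd.add hsub
  have hcontE : ∀ k, ∀ x ∈ Pset, ContinuousOn
      (fun s => b k s * F x s (c k s) - l / 2 * (F x s 1 - F x s 0)) (Icc 0 T) := fun k x hx =>
    ((hb.continuous k).continuousOn.mul (hcomp k x hx)).sub
      (continuousOn_const.mul ((hcont 1 hm1 x hx).sub (hcont 0 hm0 x hx)))
  have herr : NullIntegral T fun k x s =>
      (b k s * F x s (c k s) - l / 2 * (F x s 1 - F x s 0)) -
        (b k s * ((F x s 1 + F x s 0) * (1 / 2)) +
          (b k s * q k s - l) * ((F x s 1 - F x s 0) * (1 / 2))) := by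
    refine ⟨fun k x hx => (hcontE k x hx).sub (hmain.1 k x hx), fun ε hε => ?_⟩
    have hlim := tendsto_const_div_add_one ((2 * C + |l| / 2 * (2 * C)) + (2 * C + 2 * C))
    filter_upwards [hlim.eventually_lt_const hε] with k hk x hx t ht
    refine lt_of_le_of_lt ?_ hk
    have hk0 : (0:ℝ) ≤ 1 / ((k : ℝ) + 1) := by positivity
    rw [div_eq_mul_one_div _ ((k : ℝ) + 1)]
    refine abs_integral_le_of_eq_zero (hBm k) hk0 (hB k) ht (fun s hs => ?_)
      fun s hs hsB => ?_
    · have h1 := hFC x hx s hs 1 hm1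
      have h0 := hFC x hx s hs 0 hm0
      have hcs := hFC x hx s hs _ (hc1 k s)
      have hadd2 : |(F x s 1 + F x s 0) * (1 / 2)| ≤ C := by
        rw [abs_le] at h1 h0 ⊢; constructor <;> linarith
      have hsub1 : |F x s 1 - F x s 0| ≤ 2 * C := by
        rw [abs_le] at h1 h0 ⊢; constructor <;> linarith
      have hsub2 : |(F x s 1 - F x s 0) * (1 / 2)| ≤ C := by
        rw [abs_le] at h1 h0 ⊢; constructor <;> linarith
      have hl : |l / 2| = |l| / 2 := by rw [abs_div, abs_two]
      refine (abs_sub _ _).trans (add_le_add ((abs_sub _ _).trans (add_le_add ?_ ?_))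
        ((abs_add_le _ _).trans (add_le_add ?_ ?_)))
      · rw [abs_mul]; exact mul_le_mul (hb.abs_le k s) hcs (abs_nonneg _) (by norm_num)
      · rw [abs_mul, hl]; exact mul_le_mul_of_nonneg_left hsub1 (by positivity)
      · rw [abs_mul]; exact mul_le_mul (hb.abs_le k s) hadd2 (abs_nonneg _) (by norm_num)
      · rw [abs_mul]; exact mul_le_mul (hbq.abs_le k s) hsub2 (abs_nonneg _) (by norm_num)
    · rcases hgood k s hsB with ⟨hcs | hcs, hq⟩ | ⟨hcs, hq⟩
      · rw [hcs, hq, hF1 x hx s hs]; ring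
      · rw [hcs, hq]; ring
      · rw [hcs, hq]; ring
  have := hmain.add herr
  refine ⟨hcontE, fun ε hε => ?_⟩
  filter_upwards [this.2 ε hε] with k hk x hx t ht
  simpa using hk x hx t ht

/-- Theorem 4.4: existence of the new oscillatory processes. -/
theorem statement_13 (T : ℝ) (hT : 0 < T) (M : ℕ) :
    ∃ a₁ a₂ : Fin M → ℕ → ℝ → ℝ,
      (∀ (m : Fin M) (k : ℕ), ContDiff ℝ (⊤ : ℕ∞) (a₁ m k) ∧ ContDiff ℝ (⊤ : ℕ∞) (a₂ m k) ∧
        (∀ s, a₁ m k s ∈ Icc (-1:ℝ) 1) ∧ (∀ s, a₂ m k s ∈ Icc (-1:ℝ) 1)) ∧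
      ∀ (G₁ G₂ : Fin M → Pt → ℝ → ℝ)
        (F₁₁ F₁₂ F₂₁ F₂₂ : Fin M → Fin M → Pt → ℝ → ℝ → ℝ),
        (∃ C : ℝ, ∀ (m n : Fin M), ∀ x ∈ Pset, ∀ t ∈ Icc (0:ℝ) T,
          |G₁ m x t| ≤ C ∧ |G₂ m x t| ≤ C ∧
          ∀ a ∈ Icc (-1:ℝ) 1,
            |F₁₁ m n x t a| ≤ C ∧ |F₁₂ m n x t a| ≤ C ∧
            |F₂₁ m n x t a| ≤ C ∧ |F₂₂ m n x t a| ≤ C) →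
        (∀ m : Fin M,
          UniformContinuousOn (fun z : Pt × ℝ => G₁ m z.1 z.2) (Pset ×ˢ Icc (0:ℝ) T) ∧
          UniformContinuousOn (fun z : Pt × ℝ => G₂ m z.1 z.2) (Pset ×ˢ Icc (0:ℝ) T)) →
        (∀ m n : Fin M,
          UniformContinuousOn (fun z : (Pt × ℝ) × ℝ => F₁₁ m n z.1.1 z.1.2 z.2)
            ((Pset ×ˢ Icc (0:ℝ) T) ×ˢ Icc (-1:ℝ) 1) ∧
          UniformContinuousOn (fun z : (Pt × ℝ) × ℝ => F₁₂ m n z.1.1 z.1.2 z.2)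
            ((Pset ×ˢ Icc (0:ℝ) T) ×ˢ Icc (-1:ℝ) 1) ∧
          UniformContinuousOn (fun z : (Pt × ℝ) × ℝ => F₂₁ m n z.1.1 z.1.2 z.2)
            ((Pset ×ˢ Icc (0:ℝ) T) ×ˢ Icc (-1:ℝ) 1) ∧
          UniformContinuousOn (fun z : (Pt × ℝ) × ℝ => F₂₂ m n z.1.1 z.1.2 z.2)
            ((Pset ×ˢ Icc (0:ℝ) T) ×ˢ Icc (-1:ℝ) 1)) →
        (∀ m n : Fin M, ∀ x ∈ Pset, ∀ t ∈ Icc (0:ℝ) T,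
          F₁₁ m n x t (-1) = F₁₁ m n x t 1 ∧ F₁₂ m n x t (-1) = F₁₂ m n x t 1 ∧
          F₂₁ m n x t (-1) = F₂₁ m n x t 1 ∧ F₂₂ m n x t (-1) = F₂₂ m n x t 1) →
        ∀ m : Fin M,
          TendstoUniformlyOn
            (fun (k : ℕ) (z : Pt × ℝ) =>
              ∫ s in (0:ℝ)..z.2, a₂ m k s * (G₂ m z.1 s +
                ∑ n : Fin M, (F₂₁ m n z.1 s (a₁ n k s) + F₂₂ m n z.1 s (a₂ n k s))))
            (fun z : Pt × ℝ =>
              (1 / 2) * ∫ s in (0:ℝ)..z.2, (F₂₁ m m z.1 s 1 - F₂₁ m m z.1 s 0))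
            atTop (Pset ×ˢ Icc (0:ℝ) T) ∧
          TendstoUniformlyOn
            (fun (k : ℕ) (z : Pt × ℝ) =>
              ∫ s in (0:ℝ)..z.2, a₁ m k s * (G₁ m z.1 s +
                ∑ n : Fin M, (F₁₁ m n z.1 s (a₁ n k s) + F₁₂ m n z.1 s (a₂ n k s))))
            (fun _ : Pt × ℝ => 0)
            atTop (Pset ×ˢ Icc (0:ℝ) T) := by
  choose r hrs hr1 hra hrp hrv using exists_smooth_rademacher T (M + 1)
  have hrc : ∀ k j, Continuous (r k j) := fun k j => (hrs k j).continuous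
  have hr1' : ∀ k j s, -1 ≤ r k j s ∧ r k j s ≤ 1 := fun k j s => abs_le.1 (hr1 k j s)
  set a₁ : Fin M → ℕ → ℝ → ℝ := fun m k s => (1 + r k (m + 1) s) / 2 * r k 0 s with ha₁
  set a₂ : Fin M → ℕ → ℝ → ℝ := fun m k s => r k (m + 1) s with ha₂
  have ha₁c : ∀ m k, Continuous (a₁ m k) := fun m k =>
    ((continuous_const.add (hrc k _)).div_const 2).mul (hrc k 0)
  have ha₂c : ∀ m k, Continuous (a₂ m k) := fun m k => hrc k _
  have ha₁1 : ∀ m k s, |a₁ m k s| ≤ 1 := by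
    intro m k s
    have h1 := hr1' k (m + 1) s
    have h2 : |(1 + r k (m + 1) s) / 2| ≤ 1 := by
      rw [abs_le]; constructor <;> linarith
    simp only [ha₁, abs_mul]
    exact mul_le_one₀ h2 (abs_nonneg _) (hr1 k 0 s)
  have ha₂1 : ∀ m k s, |a₂ m k s| ≤ 1 := fun m k s => hr1 k _ s
  refine ⟨a₁, a₂, fun m k => ⟨?_, hrs k _, fun s => abs_le.1 (ha₁1 m k s),
    fun s => abs_le.1 (ha₂1 m k s)⟩, ?_⟩
  · exact ((contDiff_const.add (hrs k _)).div_const 2).mul (hrs k 0)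
  intro G₁ G₂ F₁₁ F₁₂ F₂₁ F₂₂ ⟨C, hC⟩ hG hF hF1 m
  set B : ℕ → Set ℝ := fun k => {s : ℝ | ∃ j < M + 1, r k j s ^ 2 ≠ 1} with hB
  have hBm : ∀ k, MeasurableSet (B k) := by
    intro k
    have : B k = ⋃ j, ⋃ _ : j < M + 1, {s : ℝ | r k j s ^ 2 ≠ 1} := by
      ext s; simp only [hB, mem_ofPred_eq, mem_iUnion, exists_prop]
    rw [this]
    exact (isOpen_iUnion fun j => isOpen_iUnion fun _ =>
      isOpen_ne_fun ((hrc k j).pow 2) continuous_const).measurableSet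
  have hgood : ∀ k, ∀ s ∉ B k, ∀ j < M + 1, r k j s = 1 ∨ r k j s = -1 := by
    intro k s hs j hj
    by_contra hcon
    exact hs ⟨j, hj, fun h => hcon (sq_eq_one_iff.1 h)⟩
  have hgood₁ : ∀ (n : Fin M) (k : ℕ), ∀ s ∉ B k, (a₁ n k s = -1 ∨ a₁ n k s = 1) ∧ a₂ n k s = 1 ∨
      a₁ n k s = 0 ∧ a₂ n k s = -1 := by
    intro n k s hs
    simp only [ha₁, ha₂]
    rcases hgood k s hs (n + 1) (by omega) with h | h <;>
      rcases hgood k s hs 0 (by omega) with h0 | h0 <;> rw [h, h0] <;> norm_num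
  have hgood₂ : ∀ (n : Fin M) (k : ℕ), ∀ s ∉ B k, (a₂ n k s = -1 ∨ a₂ n k s = 1) ∧ (1:ℝ) = 1 ∨
      a₂ n k s = 0 ∧ (1:ℝ) = -1 := fun n k s hs =>
    Or.inl ⟨(hgood k s hs (n + 1) (by omega)).symm, rfl⟩
  have hw₂ : WeaklyNull T (a₂ m) :=
    .of_antiperiodic (ha₂c m) (ha₂1 m) (m + 1) fun k => hra k _
  have hw₁ : WeaklyNull T (a₁ m) := by
    refine .of_antiperiodic (ha₁c m) (ha₁1 m) 0 fun k s => ?_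
    simp only [ha₁]
    rw [hra k 0 s, hrp k 0 (m + 1) (by omega) s]
    ring
  have hw₁₂ : ∀ n, WeaklyNull T fun k s => a₁ m k s * a₂ n k s := by
    intro n
    refine .of_antiperiodic (fun k => (ha₁c m k).mul (ha₂c n k)) (fun k s => ?_) 0 fun k s => ?_
    · rw [abs_mul]
      exact mul_le_one₀ (ha₁1 m k s) (abs_nonneg _) (ha₂1 n k s)
    · simp only [ha₁, ha₂]
      rw [hra k 0 s, hrp k 0 (m + 1) (by omega) s, hrp k 0 (n + 1) (by omega) s]
      ring
  have hw₂₂ : ∀ n, WeaklyNull T fun k s => a₂ m k s * a₂ n k s - if n = m then 1 else 0 := by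
    intro n
    split_ifs with hnm
    · subst hnm
      have hle : ∀ k s, |a₂ n k s * a₂ n k s - 1| ≤ 1 := by
        intro k s
        have := abs_le.1 (ha₂1 n k s)
        rw [abs_le]; constructor <;> nlinarith
      refine ⟨fun k => ((ha₂c n k).mul (ha₂c n k)).sub continuous_const,
        fun k s => (hle k s).trans one_le_two, fun k t ht => ?_⟩
      have hk0 : (0:ℝ) ≤ 1 / ((k : ℝ) + 1) := by positivity
      refine (abs_integral_le_of_eq_zero (hBm k) hk0 (hrv k) ht (fun s _ => hle k s)
        fun s _ hs => ?_).trans ?_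
      · rcases hgood k s hs (n + 1) (by omega) with h | h <;> simp [ha₂, h]
      · rw [one_mul]
        gcongr
        norm_num
    · simp only [sub_zero]
      have hc : ∀ k, Continuous fun s => a₂ m k s * a₂ n k s := fun k => (ha₂c m k).mul (ha₂c n k)
      have hle : ∀ k s, |a₂ m k s * a₂ n k s| ≤ 1 := by
        intro k s
        rw [abs_mul]
        exact mul_le_one₀ (ha₂1 m k s) (abs_nonneg _) (ha₂1 n k s)
      rcases lt_or_gt_of_ne (fun h => hnm (Fin.ext h) : (n : ℕ) ≠ m) with h | h
      · refine .of_antiperiodic hc hle (n + 1) fun k s => ?_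
        simp only [ha₂]
        rw [hra k (n + 1) s, hrp k (n + 1) (m + 1) (by omega) s]
        ring
      · refine .of_antiperiodic hc hle (m + 1) fun k s => ?_
        simp only [ha₂]
        rw [hra k (m + 1) s, hrp k (m + 1) (n + 1) (by omega) s]
        ring
  have hone : ∀ {b : ℕ → ℝ → ℝ}, WeaklyNull T b → WeaklyNull T fun k s => b k s * 1 - 0 := by
    intro b hb
    simpa using hb
  constructor
  · have hG₂ := hw₂.nullIntegral_mul (fun x hx t ht => (hC m m x hx t ht).2.1) (hG m).2
    have h₂₁ := fun n => nullIntegral_mul_comp hBm hrv hw₂ (hw₂₂ n) (ha₁c n)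
      (fun k s => abs_le.1 (ha₁1 n k s)) (hgood₁ n)
      (fun x hx t ht a ha => ((hC m n x hx t ht).2.2 a ha).2.2.1) (hF m n).2.2.1
      (fun x hx t ht => (hF1 m n x hx t ht).2.2.1)
    have h₂₂ := fun n => nullIntegral_mul_comp hBm hrv hw₂ (hone hw₂) (ha₂c n)
      (fun k s => abs_le.1 (ha₂1 n k s)) (hgood₂ n)
      (fun x hx t ht a ha => ((hC m n x hx t ht).2.2 a ha).2.2.2) (hF m n).2.2.2
      (fun x hx t ht => (hF1 m n x hx t ht).2.2.2)
    have hnull := hG₂.add (NullIntegral.sum Finset.univ fun n _ => (h₂₁ n).add (h₂₂ n))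
    refine hnull.tendstoUniformlyOn fun k x hx t ht => ?_
    have hcont : ∀ a ∈ Icc (-1:ℝ) 1, ContinuousOn (fun s => F₂₁ m m x s a) (Icc 0 T) :=
      fun a ha => (hF m m).2.2.1.continuousOn.comp (f := fun s => ((x, s), a)) (by fun_prop)
        fun s hs => ⟨⟨hx, hs⟩, ha⟩
    have hint : IntervalIntegrable (fun s => 1 / 2 * (F₂₁ m m x s 1 - F₂₁ m m x s 0)) volume 0 t :=
      ((continuousOn_const.mul ((hcont 1 (by norm_num)).sub (hcont 0 (by norm_num)))).mono
        (uIcc_subset_Icc ⟨le_rfl, hT.le⟩ ht)).intervalIntegrable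
    rw [sub_eq_iff_eq_add, ← intervalIntegral.integral_const_mul,
      ← intervalIntegral.integral_add (hnull.intervalIntegrable k hx ht) hint]
    refine intervalIntegral.integral_congr fun s _ => ?_
    simp only [mul_add, Finset.mul_sum, Finset.sum_add_distrib, Finset.sum_sub_distrib, ite_div,
      ite_mul, zero_div, zero_mul, Finset.sum_ite_eq', Finset.mem_univ, if_true,
      Finset.sum_const_zero]
    ring
  · have hG₁ := hw₁.nullIntegral_mul (fun x hx t ht => (hC m m x hx t ht).1) (hG m).1
    have h₁₁ := fun n => nullIntegral_mul_comp (l := 0) hBm hrv hw₁ (by simpa using hw₁₂ n) (ha₁c n)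
      (fun k s => abs_le.1 (ha₁1 n k s)) (hgood₁ n)
      (fun x hx t ht a ha => ((hC m n x hx t ht).2.2 a ha).1) (hF m n).1
      (fun x hx t ht => (hF1 m n x hx t ht).1)
    have h₁₂ := fun n => nullIntegral_mul_comp hBm hrv hw₁ (hone hw₁) (ha₂c n)
      (fun k s => abs_le.1 (ha₂1 n k s)) (hgood₂ n)
      (fun x hx t ht a ha => ((hC m n x hx t ht).2.2 a ha).2.1) (hF m n).2.1
      (fun x hx t ht => (hF1 m n x hx t ht).2.1)
    have hnull := hG₁.add (NullIntegral.sum Finset.univ fun n _ => (h₁₁ n).add (h₁₂ n))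
    refine hnull.tendstoUniformlyOn fun k x hx t ht => ?_
    rw [sub_zero]
    refine intervalIntegral.integral_congr fun s _ => ?_
    simp only [mul_add, Finset.mul_sum, zero_div, zero_mul, sub_zero]
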